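/- For $A\in\mathbb Z^{m\times n}$ and $b\in\mathbb Z^m$ let $N(A,b)$ denote the set of vertices (extreme points) of the convex hull of $\{x\in\mathbb Z^n : Ax\le b\}$, and let $$\xi_n(m)=\binom{m-\lfloor (n-1)/2\rfloor-1}{\lfloor n/2\rfloor}+\binom{m-\lfloor n/2\rfloor-1}{\lfloor (n-1)/2\rfloor}.$$ For every natural number $n\ge 2$ there is a constant $c'_n>0$, depending only on $n$, such that the following holds. For every natural number $m\ge n+1$ there is a natural number $\alpha_0=\alpha_0(n,m)$ such that for every natural number $\alpha\ge\alpha_0$ there exist a matrix $A\in\mathbb Z^{m\times n}$ with all entries of absolute value at most $\alpha$ and a vector $b\in\mathbb Z^m$ with $$|N(A,b)|\ \ge\ \frac{\xi_n(m)}{4^{n+2}\,n^n\,(n-1)!}\,(\ln\alpha)^{n-1}\qquad\text{and}\qquad |N(A,b)|\ \ge\ c'_n\,m^{\lfloor n/2\rfloor}\,(\log_2\alpha)^{n-1}.$$ -/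

import Mathlib

/-- The polyhedron `P = {x ∈ ℝⁿ : Ax ≤ b}`. -/
def polyhedronP (m n : ℕ) (A : Matrix (Fin m) (Fin n) ℤ) (b : Fin m → ℤ) :
    Set (Fin n → ℝ) :=
  {x | ∀ i, ∑ j, (A i j : ℝ) * x j ≤ (b i : ℝ)}

/-- The set `M(A,b) = P ∩ ℤⁿ`, viewed inside `ℝⁿ`. -/
def intPoints (m n : ℕ) (A : Matrix (Fin m) (Fin n) ℤ) (b : Fin m → ℤ) :
    Set (Fin n → ℝ) :=
  polyhedronP m n A b ∩ {x | ∀ j, ∃ z : ℤ, x j = (z : ℝ)}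

/-- `N(A,b)`: the set of vertices (extreme points) of `P_I`, the convex hull of `M(A,b)`. -/
def vertN (m n : ℕ) (A : Matrix (Fin m) (Fin n) ℤ) (b : Fin m → ℤ) :
    Set (Fin n → ℝ) :=
  Set.extremePoints ℝ (convexHull ℝ (intPoints m n A b))

/-- `ξₙ(m) = C(m − ⌊(n−1)/2⌋ − 1, ⌊n/2⌋) + C(m − ⌊n/2⌋ − 1, ⌊(n−1)/2⌋)`; for `1 ≤ n < m`
none of the natural-number subtractions truncates. -/
def xi (n m : ℕ) : ℕ :=
  Nat.choose (m - (n - 1) / 2 - 1) (n / 2) + Nat.choose (m - n / 2 - 1) ((n - 1) / 2)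

/-- The `n`-element subsets `I` of `{0, …, m - 1}` such that `∏ i ∈ I, (k - i)` is nonnegative
for every natural number `k`. -/
noncomputable def galeSets (m n : ℕ) : Finset (Finset ℕ) :=
  open Classical in
  ((Finset.range m).powersetCard n).filter fun I => ∀ k : ℕ, 0 ≤ ∏ i ∈ I, ((k : ℤ) - (i : ℤ))

theorem mem_galeSets {m n : ℕ} {I : Finset ℕ} :
    I ∈ galeSets m n ↔ (I ⊆ Finset.range m ∧ I.card = n) ∧
      ∀ k : ℕ, 0 ≤ ∏ i ∈ I, ((k : ℤ) - (i : ℤ)) := by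
  simp [galeSets, Finset.mem_powersetCard]

theorem one_le_card_galeSets (m e : ℕ) (he : e ≤ 1) : 1 ≤ (galeSets (m + e) e).card := by
  refine Finset.card_pos.mpr ⟨Finset.range e, mem_galeSets.mpr ⟨⟨?_, by simp⟩, ?_⟩⟩
  · exact Finset.range_subset_range.mpr (by omega)
  · intro k
    interval_cases e <;> simp

theorem card_galeSets_add_le (m n : ℕ) :
    (galeSets m n).card + (galeSets (m + 1) (n + 2)).card ≤ (galeSets (m + 2) (n + 2)).card := by
  classical
  have hnot : ∀ I ∈ galeSets m n, m ∉ I ∧ m + 1 ∉ I := fun I hI => by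
    have h := (mem_galeSets.mp hI).1.1
    constructor <;> intro h' <;> have := Finset.mem_range.mp (h h') <;> omega
  let g : Finset ℕ → Finset ℕ := fun I => insert m (insert (m + 1) I)
  have hinj : Set.InjOn g (galeSets m n) := by
    intro I hI J hJ hIJ
    have h1 : ∀ I ∈ galeSets m n, ((g I).erase m).erase (m + 1) = I := fun I hI => by
      have h := hnot I hI
      have : m ∉ insert (m + 1) I := by simp [h.1]
      simp only [g]
      rw [Finset.erase_insert this, Finset.erase_insert h.2]
    rw [← h1 I hI, ← h1 J hJ, hIJ]
  rw [← Finset.card_image_of_injOn hinj, ← Finset.card_union_of_disjoint]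
  · refine Finset.card_le_card (Finset.union_subset ?_ ?_)
    · intro J hJ
      obtain ⟨I, hI, rfl⟩ := Finset.mem_image.mp hJ
      have h := hnot I hI
      have h' : m ∉ insert (m + 1) I := by simp [h.1]
      obtain ⟨⟨hs, hc⟩, hk⟩ := mem_galeSets.mp hI
      refine mem_galeSets.mpr ⟨⟨?_, ?_⟩, fun k => ?_⟩
      · intro i hi
        simp only [g, Finset.mem_insert] at hi
        rw [Finset.mem_range]
        rcases hi with rfl | rfl | hi
        · omega
        · omega
        · have := Finset.mem_range.mp (hs hi); omega
      · simp only [g]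
        rw [Finset.card_insert_of_notMem h', Finset.card_insert_of_notMem h.2, hc]
      · simp only [g]
        rw [Finset.prod_insert h', Finset.prod_insert h.2, ← mul_assoc]
        refine mul_nonneg ?_ (hk k)
        push_cast
        rcases le_or_gt k m with hle | hgt
        · apply mul_nonneg_of_nonpos_of_nonpos <;> omega
        · apply mul_nonneg <;> omega
    · intro I hI
      obtain ⟨⟨hs, hc⟩, hk⟩ := mem_galeSets.mp hI
      exact mem_galeSets.mpr
        ⟨⟨hs.trans (Finset.range_subset_range.mpr (by omega)), hc⟩, hk⟩
  · rw [Finset.disjoint_left]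
    intro J hJ hJ'
    obtain ⟨I, hI, rfl⟩ := Finset.mem_image.mp hJ
    have : m + 1 ∈ g I := by simp [g]
    have := Finset.mem_range.mp ((mem_galeSets.mp hJ').1.1 this)
    omega

theorem choose_le_card_galeSets (e : ℕ) (he : e ≤ 1) :
    ∀ m k : ℕ, (m - k).choose k ≤ (galeSets (m + e) (2 * k + e)).card
  | m, 0 => by simpa using one_le_card_galeSets m e he
  | 0, k + 1 => by simp
  | 1, k + 1 => by
    rw [Nat.choose_eq_zero_of_lt (by omega)]; exact Nat.zero_le _
  | m + 2, k + 1 => by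
    rcases le_or_gt k m with hk | hk
    · have h1 := choose_le_card_galeSets e he m k
      have h2 := choose_le_card_galeSets e he (m + 1) (k + 1)
      have h3 := card_galeSets_add_le (m + e) (2 * k + e)
      have e1 : m + 2 - (k + 1) = (m - k) + 1 := by omega
      have e2 : m + 1 - (k + 1) = m - k := by omega
      have e3 : m + 1 + e = m + e + 1 := by omega
      have e4 : 2 * (k + 1) + e = 2 * k + e + 2 := by omega
      have e5 : m + 2 + e = m + e + 2 := by omega
      rw [e2, e3, e4] at h2
      rw [e1, e4, e5, Nat.choose_succ_succ']
      omega
    · rw [Nat.choose_eq_zero_of_lt (by omega)]; exact Nat.zero_le _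

theorem choose_le_card_galeSets' {m n : ℕ} (hn : 1 ≤ n) (hm : n + 1 ≤ m) :
    (m - (n - 1) / 2 - 1).choose (n / 2) ≤ (galeSets m n).card := by
  rcases Nat.even_or_odd' n with ⟨k, rfl | rfl⟩
  · have h := choose_le_card_galeSets 0 (by omega) m k
    rw [show m - (2 * k - 1) / 2 - 1 = m - k by omega, show 2 * k / 2 = k by omega]
    simpa using h
  · have h := choose_le_card_galeSets 1 le_rfl (m - 1) k
    rw [show m - (2 * k + 1 - 1) / 2 - 1 = m - 1 - k by omega,
      show (2 * k + 1) / 2 = k by omega]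
    rwa [show m - 1 + 1 = m by omega] at h

theorem xi_le_two_mul_choose {m n : ℕ} (hn : 1 ≤ n) (hm : n + 1 ≤ m) :
    xi n m ≤ 2 * (m - (n - 1) / 2 - 1).choose (n / 2) := by
  rw [xi, two_mul]
  refine Nat.add_le_add_left ?_ _
  rcases Nat.even_or_odd' n with ⟨k, rfl | rfl⟩
  · obtain ⟨k, rfl⟩ : ∃ j, k = j + 1 := ⟨k - 1, by omega⟩
    rw [show m - (2 * (k + 1) - 1) / 2 - 1 = (m - 2 * (k + 1) / 2 - 1) + 1 by omega,
      show 2 * (k + 1) / 2 = k + 1 by omega, show (2 * (k + 1) - 1) / 2 = k by omega,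
      Nat.choose_succ_succ]
    omega
  · rw [show (2 * k + 1 - 1) / 2 = k by omega, show (2 * k + 1) / 2 = k by omega]

theorem pow_div_factorial_le_xi {m n : ℕ} (hn : 2 ≤ n) (hm : n + 1 ≤ m) :
    ((m : ℝ) / n) ^ (n / 2) / (n / 2).factorial ≤ xi n m := by
  have h1 := Nat.pow_le_choose (α := ℝ) (n / 2) (m - (n - 1) / 2 - 1)
  have h2 : ((m - (n - 1) / 2 - 1).choose (n / 2) : ℝ) ≤ xi n m := by
    exact_mod_cast Nat.le_add_right _ _
  refine le_trans ?_ (h1.trans h2)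
  rw [show m - (n - 1) / 2 - 1 + 1 - n / 2 = m - n + 1 by omega]
  gcongr
  have hn' : (2 : ℝ) ≤ n := by exact_mod_cast hn
  have hm' : (n : ℝ) + 1 ≤ m := by exact_mod_cast hm
  rw [div_le_iff₀ (by linarith)]
  push_cast [Nat.cast_sub (show n ≤ m by omega)]
  nlinarith

theorem card_le_card_existsUnique {Ω X : Type*} [Fintype Ω] (R : Ω → X → Prop)
    (G T : Finset X) (p C : ℕ) (hp : 0 < p) (hGT : G ⊆ T) (hT : 2 * T.card ≤ p)
    (hG : p ≤ C * G.card)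
    (single : ∀ x ∈ G, Nat.card Ω ≤ p * Nat.card {ω // R ω x})
    (pair : ∀ x ∈ G, ∀ y ∈ T, y ≠ x → p ^ 2 * Nat.card {ω // R ω x ∧ R ω y} ≤ Nat.card Ω) :
    Nat.card Ω ≤ 2 * C * Nat.card {ω // ∃ x ∈ G, R ω x ∧ ∀ y ∈ T, R ω y → y = x} := by
  classical
  simp only [Nat.card_eq_fintype_card, Fintype.card_subtype] at *
  set E : X → Finset Ω := fun x => Finset.univ.filter fun ω => R ω x ∧ ∀ y ∈ T, R ω y → y = x
  have hE : ∀ x ∈ G, Fintype.card Ω ≤ 2 * p * (E x).card := by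
    intro x hx
    have hsub : (Finset.univ.filter fun ω => R ω x) ⊆
        E x ∪ (T.erase x).biUnion fun y => Finset.univ.filter fun ω => R ω x ∧ R ω y := by
      intro ω hω
      have hω' := (Finset.mem_filter.mp hω).2
      by_cases h : ∀ y ∈ T, R ω y → y = x
      · exact Finset.mem_union_left _ (Finset.mem_filter.mpr ⟨Finset.mem_univ _, hω', h⟩)
      · push Not at h
        obtain ⟨y, hy, hRy, hne⟩ := h
        refine Finset.mem_union_right _ (Finset.mem_biUnion.mpr ⟨y, ?_, ?_⟩)
        · exact Finset.mem_erase.mpr ⟨hne, hy⟩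
        · simp [hω', hRy]
    have h1 := (Finset.card_le_card hsub).trans (Finset.card_union_le _ _)
    have h2 : p ^ 2 * ((T.erase x).biUnion fun y =>
        Finset.univ.filter fun ω => R ω x ∧ R ω y).card ≤ T.card * Fintype.card Ω := by
      calc _ ≤ p ^ 2 * ∑ y ∈ T.erase x, (Finset.univ.filter fun ω => R ω x ∧ R ω y).card :=
            Nat.mul_le_mul_left _ Finset.card_biUnion_le
        _ = ∑ y ∈ T.erase x, p ^ 2 * (Finset.univ.filter fun ω => R ω x ∧ R ω y).card :=
            Finset.mul_sum _ _ _
        _ ≤ ∑ y ∈ T.erase x, Fintype.card Ω :=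
            Finset.sum_le_sum fun y hy =>
              pair x hx y (Finset.mem_of_mem_erase hy) (Finset.ne_of_mem_erase hy)
        _ = (T.erase x).card * Fintype.card Ω := by simp
        _ ≤ _ := Nat.mul_le_mul_right _ (Finset.card_le_card (Finset.erase_subset _ _))
    have h3 := single x hx
    have h4 : p * (p * (Finset.univ.filter fun ω => R ω x).card) ≤
        p ^ 2 * (E x).card + T.card * Fintype.card Ω := by
      nlinarith [Nat.mul_le_mul_left (p ^ 2) h1]
    have h5 : 2 * (T.card * Fintype.card Ω) ≤ p * Fintype.card Ω := by
      nlinarith [Nat.mul_le_mul_right (Fintype.card Ω) hT]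
    have h6 := Nat.mul_le_mul_left p h3
    refine Nat.le_of_mul_le_mul_left (c := p) ?_ hp
    nlinarith
  have hU : G.biUnion E ⊆
      Finset.univ.filter fun ω => ∃ x ∈ G, R ω x ∧ ∀ y ∈ T, R ω y → y = x := by
    intro ω hω
    obtain ⟨x, hx, h⟩ := Finset.mem_biUnion.mp hω
    simp only [E, Finset.mem_filter, Finset.mem_univ, true_and] at h ⊢
    exact ⟨x, hx, h⟩
  have hdisj : (G : Set X).PairwiseDisjoint E := by
    intro x hx y hy hxy
    rw [Function.onFun, Finset.disjoint_left]
    intro ω h1 h2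
    simp only [E, Finset.mem_filter, Finset.mem_univ, true_and] at h1 h2
    exact hxy (h2.2 x (hGT hx) h1.1)
  have hc := Finset.card_le_card hU
  rw [Finset.card_biUnion hdisj] at hc
  have hs : G.card * Fintype.card Ω ≤ 2 * p * ∑ x ∈ G, (E x).card := by
    rw [Finset.mul_sum, ← smul_eq_mul, ← Finset.sum_const]
    exact Finset.sum_le_sum hE
  refine Nat.le_of_mul_le_mul_left (c := p) ?_ hp
  calc p * Fintype.card Ω ≤ C * G.card * Fintype.card Ω := Nat.mul_le_mul_right _ hG
    _ = C * (G.card * Fintype.card Ω) := by ring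
    _ ≤ C * (2 * p * ∑ x ∈ G, (E x).card) := Nat.mul_le_mul_left _ hs
    _ ≤ C * (2 * p * _) := Nat.mul_le_mul_left _ (Nat.mul_le_mul_left _ hc)
    _ = _ := by ring

theorem exists_card_le_of_forall_card_le {Ω J : Type*} [Fintype Ω] [Nonempty Ω]
    (P : Finset J) (Q : Ω → J → Prop) (C : ℕ)
    (h : ∀ j ∈ P, Nat.card Ω ≤ C * Nat.card {ω // Q ω j}) :
    ∃ (ω : Ω) (S : Finset J), S ⊆ P ∧ (∀ j ∈ S, Q ω j) ∧ P.card ≤ C * S.card := by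
  classical
  simp only [Nat.card_eq_fintype_card, Fintype.card_subtype] at h
  by_contra hcon
  push Not at hcon
  have h1 : ∀ ω, C * (P.filter fun j => Q ω j).card < P.card := fun ω =>
    hcon ω _ (Finset.filter_subset _ _) fun j hj => (Finset.mem_filter.mp hj).2
  have h2 : ∑ ω : Ω, C * (P.filter fun j => Q ω j).card < ∑ _ω : Ω, P.card :=
    Finset.sum_lt_sum_of_nonempty Finset.univ_nonempty fun ω _ => h1 ω
  have h3 : ∑ j ∈ P, Fintype.card Ω ≤
      ∑ j ∈ P, C * (Finset.univ.filter fun ω => Q ω j).card := Finset.sum_le_sum h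
  rw [← Finset.mul_sum] at h2 h3
  have h4 : ∑ ω : Ω, (P.filter fun j => Q ω j).card =
      ∑ j ∈ P, (Finset.univ.filter fun ω => Q ω j).card := by
    simp only [Finset.card_filter]
    exact Finset.sum_comm
  simp only [Finset.sum_const, smul_eq_mul, Finset.card_univ] at h2 h3
  rw [h4] at h2
  nlinarith

/-- The integer vector `w` lies in the shifted lattice
`{w : w 0 ≡ ∑ j, c j * w (j + 1) + s mod p}` with parameters `ω = (c, s)`. -/
def InShiftedLattice {d p : ℕ} (ω : (Fin d → ZMod p) × ZMod p) (w : Fin (d + 1) → ℤ) : Prop :=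
  (w 0 : ZMod p) = ∑ j, ω.1 j * (w j.succ : ZMod p) + ω.2

theorem card_le_mul_card_inShiftedLattice {d p : ℕ} [NeZero p] (w : Fin (d + 1) → ℤ) :
    Nat.card ((Fin d → ZMod p) × ZMod p) ≤
      p * Nat.card {ω : (Fin d → ZMod p) × ZMod p // InShiftedLattice ω w} := by
  have h : Nat.card (Fin d → ZMod p) ≤
      Nat.card {ω : (Fin d → ZMod p) × ZMod p // InShiftedLattice ω w} := by
    refine Nat.card_le_card_of_injective
      (fun c => ⟨(c, (w 0 : ZMod p) - ∑ j, c j * (w j.succ : ZMod p)), ?_⟩) ?_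
    · simp [InShiftedLattice]
    · intro c c' h
      simpa using congrArg (fun x => x.1.1) h
  rw [Nat.card_prod, mul_comm]
  simpa using Nat.mul_le_mul_left p h

theorem sq_mul_card_inShiftedLattice_and_le {d p : ℕ} [Fact p.Prime] (w w' : Fin (d + 1) → ℤ)
    (h : ∃ j, (w j : ZMod p) ≠ (w' j : ZMod p)) :
    p ^ 2 * Nat.card {ω : (Fin d → ZMod p) × ZMod p //
      InShiftedLattice ω w ∧ InShiftedLattice ω w'} ≤
      Nat.card ((Fin d → ZMod p) × ZMod p) := by
  have hp : Nat.card (ZMod p) = p := by simp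
  by_cases hs : ∃ j : Fin d, (w j.succ : ZMod p) ≠ (w' j.succ : ZMod p)
  · obtain ⟨j, hj⟩ := hs
    have hdiff : ∀ ω : (Fin d → ZMod p) × ZMod p, InShiftedLattice ω w → InShiftedLattice ω w' →
        (w 0 : ZMod p) - w' 0 = ∑ i, ω.1 i * ((w i.succ : ZMod p) - w' i.succ) := by
      intro ω h1 h2
      unfold InShiftedLattice at h1 h2
      rw [h1, h2]
      simp only [mul_sub, Finset.sum_sub_distrib]
      ring
    have hinj : Nat.card ({ω : (Fin d → ZMod p) × ZMod p //
        InShiftedLattice ω w ∧ InShiftedLattice ω w'} × ZMod p × ZMod p) ≤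
        Nat.card ((Fin d → ZMod p) × ZMod p) := by
      refine Nat.card_le_card_of_injective
        (fun x => (x.1.1.1 + Pi.single j x.2.1, x.1.1.2 + x.2.2)) ?_
      rintro ⟨⟨⟨c, s⟩, h1, h2⟩, t, r⟩ ⟨⟨⟨c', s'⟩, h1', h2'⟩, t', r'⟩ hEq
      simp only [Prod.mk.injEq] at hEq
      obtain ⟨hc, hsr⟩ := hEq
      have e1 := hdiff _ h1 h2
      have e2 := hdiff _ h1' h2'
      have key : ∀ (c : Fin d → ZMod p) (t : ZMod p),
          ∑ i : Fin d, (c + Pi.single j t : Fin d → ZMod p) i * ((w i.succ : ZMod p) - w' i.succ) =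
          ∑ i, c i * ((w i.succ : ZMod p) - w' i.succ) + t * ((w j.succ : ZMod p) - w' j.succ) := by
        intro c t
        simp only [Pi.add_apply, add_mul, Finset.sum_add_distrib]
        congr 1
        rw [Finset.sum_eq_single j]
        · simp
        · intro i _ hij; simp [hij]
        · simp
      have e3 := key c t
      rw [hc, key c' t', ← e2] at e3
      simp only at e1
      rw [← e1] at e3
      have ht : t = t' := by
        have := add_left_cancel e3
        exact (mul_right_cancel₀ (sub_ne_zero.mpr hj) this).symm
      subst ht
      have hcc : c = c' := add_right_cancel hc
      subst hcc
      have hss : s = s' := by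
        unfold InShiftedLattice at h1 h1'
        have := h1.symm.trans h1'
        exact add_left_cancel this
      subst hss
      have : r = r' := add_left_cancel hsr
      subst this
      rfl
    rw [Nat.card_prod, Nat.card_prod, hp] at hinj
    calc _ = _ := by ring
      _ ≤ _ := hinj
  · push Not at hs
    have : IsEmpty {ω : (Fin d → ZMod p) × ZMod p //
        InShiftedLattice ω w ∧ InShiftedLattice ω w'} := by
      refine ⟨fun ⟨ω, h1, h2⟩ => ?_⟩
      obtain ⟨j, hj⟩ := h
      refine hj (Fin.cases ?_ (fun i => hs i) j)
      unfold InShiftedLattice at h1 h2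
      rw [h1, h2]
      simp [hs]
    simp

/-- The integer vectors `u` whose image `V u` lies in the half-open box `∏ [l i, r i)`. -/
def boxPreimage {n : ℕ} (V : Matrix (Fin n) (Fin n) ℤ) (l r : Fin n → ℤ) : Set (Fin n → ℤ) :=
  {u | ∀ i, l i ≤ V.mulVec u i ∧ V.mulVec u i < r i}

theorem boxPreimage_finite {n : ℕ} {V : Matrix (Fin n) (Fin n) ℤ} (hV : V.det ≠ 0)
    (l r : Fin n → ℤ) : (boxPreimage V l r).Finite := by
  have hinj : Function.Injective V.mulVec := Matrix.mulVec_injective_of_det_ne_zero hV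
  refine Set.Finite.subset ((Set.finite_Icc l r).preimage hinj.injOn) fun u hu => ?_
  exact ⟨fun i => (hu i).1, fun i => (hu i).2.le⟩

theorem ncard_boxPreimage_cell {n : ℕ} {V : Matrix (Fin n) (Fin n) ℤ} (t : Fin n → ℤ) :
    (boxPreimage V (fun i => |V.det| * t i) (fun i => |V.det| * (t i + 1))).ncard =
      (boxPreimage V (fun _ => 0) (fun _ => |V.det|)).ncard := by
  obtain ⟨z, hz⟩ : ∃ z, V.mulVec z = fun i => |V.det| * t i := by
    refine ⟨V.adjugate.mulVec (fun i => V.det.sign * t i), ?_⟩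
    rw [Matrix.mulVec_mulVec, Matrix.mul_adjugate, Matrix.smul_mulVec, Matrix.one_mulVec]
    ext i
    simp only [Pi.smul_apply, smul_eq_mul]
    rw [← mul_assoc, Int.mul_sign_self, Int.abs_eq_natAbs]
  symm
  refine Set.ncard_congr (fun u _ => u + z) ?_ ?_ ?_
  · intro u hu i
    have h := hu i
    rw [Matrix.mulVec_add, hz, Pi.add_apply]
    constructor <;> linarith
  · intro u v _ _ h
    exact add_right_cancel h
  · intro u hu
    refine ⟨u - z, fun i => ?_, by simp⟩
    have h := hu i
    rw [Matrix.mulVec_sub, hz, Pi.sub_apply]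
    constructor <;> linarith

theorem ncard_boxPreimage {n : ℕ} {V : Matrix (Fin n) (Fin n) ℤ} (hV : V.det ≠ 0)
    (l r : Fin n → ℤ) :
    (boxPreimage V (fun i => |V.det| * l i) (fun i => |V.det| * r i)).ncard =
      (∏ i, (r i - l i).toNat) * (boxPreimage V (fun _ => 0) (fun _ => |V.det|)).ncard := by
  classical
  have hD : 0 < |V.det| := abs_pos.mpr hV
  set D := |V.det| with hDdef
  have hfin := boxPreimage_finite hV (fun i => D * l i) (fun i => D * r i)
  rw [Set.ncard_eq_toFinset_card _ hfin]
  have hmaps : ∀ u ∈ hfin.toFinset, (fun i => V.mulVec u i / D) ∈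
      Fintype.piFinset fun i => Finset.Ico (l i) (r i) := by
    intro u hu
    have hu' := (Set.Finite.mem_toFinset hfin).mp hu
    rw [Fintype.mem_piFinset]
    intro i
    rw [Finset.mem_Ico, Int.le_ediv_iff_mul_le hD, Int.ediv_lt_iff_lt_mul hD, mul_comm (l i),
      mul_comm (r i)]
    exact hu' i
  rw [Finset.card_eq_sum_card_fiberwise hmaps]
  have hcell : ∀ t ∈ Fintype.piFinset fun i => Finset.Ico (l i) (r i),
      (hfin.toFinset.filter fun u => (fun i => V.mulVec u i / D) = t).card =
        (boxPreimage V (fun _ => 0) (fun _ => D)).ncard := by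
    intro t ht
    rw [← ncard_boxPreimage_cell t, ← Set.ncard_coe_finset]
    congr 1
    ext u
    simp only [Finset.coe_filter, Set.Finite.mem_toFinset, boxPreimage, Set.mem_ofPred_eq]
    have key : ∀ i, V.mulVec u i / D = t i ↔
        D * t i ≤ V.mulVec u i ∧ V.mulVec u i < D * (t i + 1) := by
      intro i
      rw [Int.ediv_eq_iff_of_pos hD, mul_comm D, mul_comm D]
      constructor <;> rintro ⟨h1, h2⟩ <;> constructor <;> linarith
    constructor
    · rintro ⟨-, h⟩ i
      exact (key i).mp (congrFun h i)
    · intro h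
      refine ⟨fun i => ?_, funext fun i => (key i).mpr (h i)⟩
      have h1 := Finset.mem_Ico.mp (Fintype.mem_piFinset.mp ht i)
      have h2 := h i
      constructor
      · nlinarith
      · nlinarith
  rw [Finset.sum_congr rfl hcell, Finset.sum_const, Fintype.card_piFinset, smul_eq_mul]
  simp

theorem abs_det_le_ncard_boxPreimage {d : ℕ} {V : Matrix (Fin (d + 1)) (Fin (d + 1)) ℤ}
    (hV : V.det ≠ 0) (h1 : ∀ i, V i 0 = 1) :
    |V.det| ≤ (boxPreimage V (fun _ => 0) (fun _ => |V.det|)).ncard := by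
  have hsub : Pi.single (M := fun _ : Fin (d + 1) => ℤ) 0 '' Set.Ico 0 |V.det| ⊆
      boxPreimage V (fun _ => 0) (fun _ => |V.det|) := by
    rintro _ ⟨a, ha, rfl⟩ i
    simpa [Matrix.mulVec_single, h1] using ha
  have h2 := Set.ncard_le_ncard hsub (boxPreimage_finite hV _ _)
  rw [Set.ncard_image_of_injective _ (Pi.single_injective 0), ← Finset.coe_Ico,
    Set.ncard_coe_finset, Int.card_Ico, sub_zero] at h2
  have := abs_nonneg V.det
  omega

theorem mem_extremePoints_convexHull_of_lt {E : Type*} [AddCommGroup E] [Module ℝ E]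
    {S : Set E} (f : E →ₗ[ℝ] ℝ) {x : E} (hx : x ∈ S) (h : ∀ y ∈ S, y ≠ x → f x < f y) :
    x ∈ Set.extremePoints ℝ (convexHull ℝ S) := by
  have hconv : Convex ℝ ({x} ∪ {y | f x < f y}) := by
    intro y hy z hz a b ha hb hab
    have hle : ∀ y ∈ ({x} ∪ {y | f x < f y} : Set E), f x ≤ f y := by
      rintro y (rfl | hy)
      · exact le_rfl
      · exact le_of_lt hy
    have hval : f (a • y + b • z) = a * f y + b * f z := by simp
    have hx' : f x = a * f x + b * f x := by rw [← add_mul, hab, one_mul]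
    have hy' := hle y hy
    have hz' := hle z hz
    rcases ha.eq_or_lt with rfl | ha
    · have : b = 1 := by linarith
      simpa [this] using hz
    rcases hb.eq_or_lt with rfl | hb
    · have : a = 1 := by linarith
      simpa [this] using hy
    rcases hy with rfl | hy
    · rcases hz with rfl | hz
      · left
        rw [Set.mem_singleton_iff, ← add_smul, hab, one_smul]
      · right
        have := mul_lt_mul_of_pos_left (show f y < f z from hz) hb
        show f y < _
        rw [hval]
        linarith
    · right
      have h1 := mul_lt_mul_of_pos_left (show f x < f y from hy) ha
      have h2 := mul_le_mul_of_nonneg_left hz' hb.le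
      show f x < _
      rw [hval]
      linarith
  have hsub : convexHull ℝ S ⊆ {x} ∪ {y | f x < f y} := by
    refine convexHull_min (fun y hy => ?_) hconv
    by_cases hyx : y = x
    · exact Or.inl hyx
    · exact Or.inr (h y hy hyx)
  rw [mem_extremePoints]
  refine ⟨subset_convexHull ℝ S hx, ?_⟩
  rintro y hy z hz ⟨a, b, ha, hb, hab, hxe⟩
  have hval : f x = a * f y + b * f z := by rw [← hxe]; simp
  have hx' : f x = a * f x + b * f x := by rw [← add_mul, hab, one_mul]
  rcases hsub hy with rfl | hy
  · rcases hsub hz with rfl | hz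
    · exact ⟨rfl, rfl⟩
    · have := mul_lt_mul_of_pos_left (show f y < f z from hz) hb
      linarith
  · exfalso
    have h1 := mul_lt_mul_of_pos_left (show f x < f y from hy) ha
    have h2 : f x ≤ f z := by
      rcases hsub hz with rfl | hz
      · exact le_rfl
      · exact le_of_lt hz
    have h3 := mul_le_mul_of_nonneg_left h2 hb.le
    linarith

theorem mem_intPoints_iff {m n : ℕ} {A : Matrix (Fin m) (Fin n) ℤ} {b : Fin m → ℤ}
    {x : Fin n → ℝ} :
    x ∈ intPoints m n A b ↔
      ∃ z : Fin n → ℤ, (∀ i, A.mulVec z i ≤ b i) ∧ x = fun j => (z j : ℝ) := by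
  constructor
  · rintro ⟨hP, hz⟩
    choose z hz using hz
    refine ⟨z, fun i => ?_, funext hz⟩
    have := hP i
    simp only [hz] at this
    rw [Matrix.mulVec, dotProduct]
    exact_mod_cast this
  · rintro ⟨z, hz, rfl⟩
    refine ⟨fun i => ?_, fun j => ⟨z j, rfl⟩⟩
    have := hz i
    rw [Matrix.mulVec, dotProduct] at this
    beta_reduce
    exact_mod_cast this

theorem vertN_finite {m n : ℕ} {A : Matrix (Fin m) (Fin n) ℤ} (b : Fin m → ℤ) :
    (vertN m n A b).Finite := by
  by_contra hinf
  have hsub : ∀ x : vertN m n A b, ∃ z : Fin n → ℤ,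
      (∀ i, A.mulVec z i ≤ b i) ∧ x.1 = fun j => (z j : ℝ) := fun x =>
    mem_intPoints_iff.mp (extremePoints_convexHull_subset x.2)
  choose z hz hxz using hsub
  have : Infinite (vertN m n A b) := Set.infinite_coe_iff.mpr hinf
  let e := Infinite.natEmbedding (vertN m n A b)
  obtain ⟨i, j, hij, hle⟩ := wellQuasiOrdered_le
    (fun k : ℕ => fun r : Fin m => (b r - A.mulVec (z (e k)) r).toNat)
  set u := z (e i) with hu
  set v := z (e j) with hv
  have hle' : ∀ r, A.mulVec v r ≤ A.mulVec u r := fun r => by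
    have h1 := hle r
    have h2 := hz (e i) r
    have h3 := hz (e j) r
    simp only at h1
    rw [← hu] at h2
    rw [← hv] at h3
    omega
  have hmem : (fun k => ((v + (v - u)) k : ℝ)) ∈ intPoints m n A b := by
    refine mem_intPoints_iff.mpr ⟨v + (v - u), fun r => ?_, by ext; simp⟩
    rw [Matrix.mulVec_add, Matrix.mulVec_sub]
    have h1 := hle' r
    have h2 := hz (e j) r
    rw [← hv] at h2
    simp only [Pi.add_apply, Pi.sub_apply]
    linarith
  have hext := (mem_extremePoints.mp (e j).2).2
  have h1 : (fun k => (u k : ℝ)) ∈ convexHull ℝ (intPoints m n A b) := by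
    rw [hu, ← hxz]; exact (e i).2.1
  have h2 := (hext _ h1 _ (subset_convexHull ℝ _ hmem) ?_).1
  · rw [hu, ← hxz] at h2
    have := e.injective (Subtype.ext h2)
    omega
  · refine ⟨1 / 2, 1 / 2, by norm_num, by norm_num, by norm_num, ?_⟩
    rw [hxz, ← hv]
    ext k
    simp
    ring

/-- The value at `t` of the polynomial with coefficient vector `u`. -/
def momentEval {d : ℕ} (u : Fin (d + 1) → ℤ) (t : ℤ) : ℤ := ∑ j, u j * t ^ (j : ℕ)

theorem momentEval_add_smul {d : ℕ} (u v : Fin (d + 1) → ℤ) (N t : ℤ) :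
    momentEval (u + N • v) t = momentEval u t + N * momentEval v t := by
  simp only [momentEval, Pi.add_apply, Pi.smul_apply, smul_eq_mul, add_mul,
    Finset.sum_add_distrib, Finset.mul_sum, mul_assoc]

/-- The integer Vandermonde matrix of a tuple of natural numbers. -/
def nodeMatrix {d : ℕ} (σ : Fin (d + 1) → ℕ) : Matrix (Fin (d + 1)) (Fin (d + 1)) ℤ :=
  Matrix.vandermonde fun a => (σ a : ℤ)

theorem nodeMatrix_mulVec {d : ℕ} (σ : Fin (d + 1) → ℕ) (u : Fin (d + 1) → ℤ)
    (a : Fin (d + 1)) : (nodeMatrix σ).mulVec u a = momentEval u (σ a) := by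
  simp only [nodeMatrix, Matrix.mulVec, dotProduct, Matrix.vandermonde_apply, momentEval]
  exact Finset.sum_congr rfl fun j _ => mul_comm _ _

theorem nodeMatrix_det_ne_zero {d : ℕ} {σ : Fin (d + 1) → ℕ} (hσ : Function.Injective σ) :
    (nodeMatrix σ).det ≠ 0 :=
  Matrix.det_vandermonde_ne_zero_iff.mpr (Nat.cast_injective.comp hσ)

theorem exists_momentEval_add_pow_eq_prod {d : ℕ} (σ : Fin (d + 1) → ℕ) :
    ∃ v : Fin (d + 1) → ℤ, ∀ t : ℤ, momentEval v t + t ^ (d + 1) = ∏ a, (t - (σ a : ℤ)) := by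
  set P : Polynomial ℤ := ∏ a, (Polynomial.X - Polynomial.C (σ a : ℤ)) with hP
  have hdeg : P.natDegree = d + 1 := by
    rw [hP, Polynomial.natDegree_finsetProd_X_sub_C_eq_card]
    simp
  have hmonic : P.Monic := Polynomial.monic_prod_X_sub_C _ _
  refine ⟨fun j => P.coeff j, fun t => ?_⟩
  have h1 : P.eval t = ∏ a, (t - (σ a : ℤ)) := by
    rw [hP, Polynomial.eval_prod]
    simp
  have h2 : P.coeff (d + 1) = 1 := by
    rw [← hdeg]; exact hmonic
  rw [← h1, Polynomial.eval_eq_sum_range, hdeg, Finset.sum_range_succ, h2, one_mul,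
    Finset.sum_range fun j => P.coeff j * t ^ j]
  rfl

section System

variable {d p : ℕ}

/-- The affine map of `ℤ^(d+1)` onto the shifted lattice with parameters `ω`. -/
def latticePoint (ω : (Fin d → ZMod p) × ZMod p) (z : Fin (d + 1) → ℤ) : Fin (d + 1) → ℤ :=
  Fin.cons (p * z 0 + ∑ j, ((ω.1 j).val : ℤ) * z j.succ + (ω.2.val : ℤ)) fun j => z j.succ

/-- The coefficient matrix of the system `momentEval w i + N * i ^ (d + 1) ≥ 0`, `i < m`, in the
coordinates `w = latticePoint ω z`. -/
def systemMatrix (m : ℕ) (ω : (Fin d → ZMod p) × ZMod p) : Matrix (Fin m) (Fin (d + 1)) ℤ :=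
  fun i => Fin.cons (-(p : ℤ)) fun j => -(((ω.1 j).val : ℤ) + (i : ℤ) ^ ((j : ℕ) + 1))

/-- The right-hand side of the system `momentEval w i + N * i ^ (d + 1) ≥ 0`, `i < m`, in the
coordinates `w = latticePoint ω z`. -/
def systemRhs (m : ℕ) (ω : (Fin d → ZMod p) × ZMod p) (N : ℤ) : Fin m → ℤ :=
  fun i => N * (i : ℤ) ^ (d + 1) + (ω.2.val : ℤ)

theorem systemRhs_sub_mulVec {m : ℕ} (ω : (Fin d → ZMod p) × ZMod p) (N : ℤ)
    (z : Fin (d + 1) → ℤ) (i : Fin m) :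
    systemRhs m ω N i - (systemMatrix m ω).mulVec z i =
      momentEval (latticePoint ω z) (i : ℤ) + N * (i : ℤ) ^ (d + 1) := by
  simp only [systemRhs, systemMatrix, Matrix.mulVec, dotProduct, momentEval, latticePoint,
    Fin.sum_univ_succ, Fin.cons_zero, Fin.cons_succ, Fin.val_zero, Fin.val_succ, pow_zero,
    neg_mul, add_mul, Finset.sum_neg_distrib, Finset.sum_add_distrib]
  have : ∑ x : Fin d, (i : ℤ) ^ ((x : ℕ) + 1) * z x.succ =
      ∑ x : Fin d, z x.succ * (i : ℤ) ^ ((x : ℕ) + 1) :=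
    Finset.sum_congr rfl fun _ _ => mul_comm _ _
  rw [this]
  ring

theorem abs_systemMatrix_le [NeZero p] (m : ℕ) (ω : (Fin d → ZMod p) × ZMod p) (i : Fin m)
    (j : Fin (d + 1)) : |systemMatrix m ω i j| ≤ (p + m ^ d : ℕ) := by
  have hm : 1 ≤ m := by have := i.2; omega
  refine Fin.cases ?_ (fun j => ?_) j
  · simp only [systemMatrix, Fin.cons_zero, abs_neg, Nat.abs_cast]
    exact_mod_cast Nat.le_add_right _ _
  · simp only [systemMatrix, Fin.cons_succ, abs_neg]
    rw [abs_of_nonneg (by positivity)]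
    have h1 : (ω.1 j).val ≤ p := (ZMod.val_lt _).le
    have h2 : (i : ℕ) ^ ((j : ℕ) + 1) ≤ m ^ d :=
      (Nat.pow_le_pow_left i.2.le _).trans (Nat.pow_le_pow_right hm (by have := j.2; omega))
    exact_mod_cast Nat.add_le_add h1 h2

theorem inShiftedLattice_latticePoint [NeZero p] (ω : (Fin d → ZMod p) × ZMod p)
    (z : Fin (d + 1) → ℤ) : InShiftedLattice ω (latticePoint ω z) := by
  simp [InShiftedLattice, latticePoint]

theorem exists_latticePoint_eq [NeZero p] {ω : (Fin d → ZMod p) × ZMod p}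
    {w : Fin (d + 1) → ℤ} (h : InShiftedLattice ω w) : ∃ z, latticePoint ω z = w := by
  have hdvd : (p : ℤ) ∣ w 0 - (∑ j, ((ω.1 j).val : ℤ) * w j.succ + (ω.2.val : ℤ)) := by
    rw [← ZMod.intCast_zmod_eq_zero_iff_dvd]
    unfold InShiftedLattice at h
    simp [h]
  obtain ⟨z0, hz0⟩ := hdvd
  refine ⟨Fin.cons z0 fun j => w j.succ, ?_⟩
  ext j
  refine Fin.cases ?_ (fun j => ?_) j
  · simp only [latticePoint, Fin.cons_zero, Fin.cons_succ]
    linarith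
  · simp [latticePoint]

theorem latticePoint_injective [NeZero p] (ω : (Fin d → ZMod p) × ZMod p) :
    Function.Injective (latticePoint ω) := by
  intro z z' h
  have hs : ∀ j : Fin d, z j.succ = z' j.succ := fun j => by
    simpa [latticePoint] using congrFun h j.succ
  ext j
  refine Fin.cases ?_ hs j
  have h0 := congrFun h 0
  simp only [latticePoint, Fin.cons_zero, hs] at h0
  have hp : (p : ℤ) ≠ 0 := by exact_mod_cast NeZero.ne p
  exact mul_left_cancel₀ hp (by linarith)

theorem exists_mem_vertN [NeZero p] {m : ℕ} {σ : Fin (d + 1) → ℕ} (hlt : ∀ a, σ a < m)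
    {v : Fin (d + 1) → ℤ} (hv : ∀ t : ℤ, momentEval v t + t ^ (d + 1) = ∏ a, (t - (σ a : ℤ)))
    (ω : (Fin d → ZMod p) × ZMod p) (N D : ℤ) (k : Fin (d + 1) → ℕ) {u : Fin (d + 1) → ℤ}
    (hu : ∀ a, (nodeMatrix σ).mulVec u a < D * (2 * 2 ^ k a))
    (hω : InShiftedLattice ω (u + N • v))
    (huniq : ∀ u' ∈ boxPreimage (nodeMatrix σ) (fun _ => D * 0)
      (fun a => D * (2 * (d + 1) * 2 ^ k a)), InShiftedLattice ω (u' + N • v) → u' = u)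
    (hfeas : ∀ i : Fin m, 0 ≤ momentEval u (i : ℤ) + N * ∏ a, ((i : ℤ) - (σ a : ℤ))) :
    ∃ z, latticePoint ω z = u + N • v ∧
      (fun j => (z j : ℝ)) ∈ vertN m (d + 1) (systemMatrix m ω) (systemRhs m ω N) := by
  obtain ⟨z, hz⟩ := exists_latticePoint_eq hω
  refine ⟨z, hz, ?_⟩
  have hslack : ∀ (u' z' : Fin (d + 1) → ℤ), latticePoint ω z' = u' + N • v → ∀ i : Fin m,
      systemRhs m ω N i - (systemMatrix m ω).mulVec z' i =
        momentEval u' (i : ℤ) + N * ∏ a, ((i : ℤ) - (σ a : ℤ)) := by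
    intro u' z' h i
    rw [systemRhs_sub_mulVec, h, momentEval_add_smul, ← hv]
    ring
  have hnode : ∀ (u' z' : Fin (d + 1) → ℤ), latticePoint ω z' = u' + N • v → ∀ a,
      systemRhs m ω N ⟨σ a, hlt a⟩ - (systemMatrix m ω).mulVec z' ⟨σ a, hlt a⟩ =
        (nodeMatrix σ).mulVec u' a := by
    intro u' z' h a
    rw [hslack u' z' h, nodeMatrix_mulVec,
      Finset.prod_eq_zero (Finset.mem_univ a) (by simp), mul_zero, add_zero]
  let f : (Fin (d + 1) → ℝ) →ₗ[ℝ] ℝ := ∑ a, ((2 : ℝ) ^ k a)⁻¹ •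
    ∑ j, (-(systemMatrix m ω ⟨σ a, hlt a⟩ j : ℝ)) • LinearMap.proj j
  have hf : ∀ z' : Fin (d + 1) → ℤ, f (fun j => (z' j : ℝ)) =
      ∑ a, ((2 : ℝ) ^ k a)⁻¹ * (-((systemMatrix m ω).mulVec z' ⟨σ a, hlt a⟩ : ℤ) : ℝ) := by
    intro z'
    simp only [f, LinearMap.sum_apply, LinearMap.smul_apply, LinearMap.proj_apply, smul_eq_mul,
      Matrix.mulVec, dotProduct]
    refine Finset.sum_congr rfl fun a _ => ?_
    push_cast
    rw [← Finset.sum_neg_distrib]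
    simp
  have hf' : ∀ (u' z' : Fin (d + 1) → ℤ), latticePoint ω z' = u' + N • v →
      f (fun j => (z' j : ℝ)) = ∑ a, ((2 : ℝ) ^ k a)⁻¹ * ((nodeMatrix σ).mulVec u' a : ℤ) -
        ∑ a, ((2 : ℝ) ^ k a)⁻¹ * (systemRhs m ω N ⟨σ a, hlt a⟩ : ℤ) := by
    intro u' z' h
    rw [hf, ← Finset.sum_sub_distrib]
    refine Finset.sum_congr rfl fun a _ => ?_
    rw [← hnode u' z' h a]
    push_cast
    ring
  refine mem_extremePoints_convexHull_of_lt f (mem_intPoints_iff.mpr ⟨z, fun i => ?_, rfl⟩) ?_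
  · have h1 := hslack u z hz i
    have h2 := hfeas i
    linarith
  · intro y hy hne
    obtain ⟨z', hz', rfl⟩ := mem_intPoints_iff.mp hy
    obtain ⟨u', hu'⟩ : ∃ u', latticePoint ω z' = u' + N • v :=
      ⟨latticePoint ω z' - N • v, by simp⟩
    rw [hf' u z hz, hf' u' z' hu']
    refine sub_lt_sub_right ?_ _
    have hpos : ∀ a, (0 : ℝ) < ((2 : ℝ) ^ k a)⁻¹ := fun a => by positivity
    have hnn : ∀ a, 0 ≤ (nodeMatrix σ).mulVec u' a := fun a => by
      rw [← hnode u' z' hu' a]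
      linarith [hz' ⟨σ a, hlt a⟩]
    have hupper : ∑ a, ((2 : ℝ) ^ k a)⁻¹ * ((nodeMatrix σ).mulVec u a : ℤ) <
        2 * (d + 1) * D := by
      calc _ < ∑ _a : Fin (d + 1), 2 * (D : ℝ) := by
            refine Finset.sum_lt_sum_of_nonempty Finset.univ_nonempty fun a _ => ?_
            have h1 : (((nodeMatrix σ).mulVec u a : ℤ) : ℝ) < D * (2 * 2 ^ k a) := by
              exact_mod_cast hu a
            rw [inv_mul_lt_iff₀ (by positivity)]
            linarith
        _ = _ := by simp; ring
    have hex : ∃ a, D * (2 * (d + 1) * 2 ^ k a) ≤ (nodeMatrix σ).mulVec u' a := by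
      by_contra hcon
      push Not at hcon
      have hmem : u' ∈ boxPreimage (nodeMatrix σ) (fun _ => D * 0)
          (fun a => D * (2 * (d + 1) * 2 ^ k a)) := fun a =>
        ⟨by simpa using hnn a, hcon a⟩
      have hEq := huniq u' hmem (hu' ▸ inShiftedLattice_latticePoint ω z')
      rw [hEq, ← hz] at hu'
      exact hne (by rw [latticePoint_injective ω hu'])
    obtain ⟨a, ha⟩ := hex
    refine hupper.trans_le ?_
    calc (2 * (d + 1) * D : ℝ) ≤ ((2 : ℝ) ^ k a)⁻¹ * ((nodeMatrix σ).mulVec u' a : ℤ) := by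
          have h1 : (D * (2 * (d + 1) * 2 ^ k a) : ℝ) ≤ ((nodeMatrix σ).mulVec u' a : ℤ) := by
            exact_mod_cast ha
          rw [le_inv_mul_iff₀ (by positivity)]
          linarith
      _ ≤ _ := Finset.single_le_sum (f := fun a => ((2 : ℝ) ^ k a)⁻¹ *
            ((nodeMatrix σ).mulVec u' a : ℤ))
            (fun b _ => mul_nonneg (hpos b).le (by exact_mod_cast hnn b)) (Finset.mem_univ a)

end System

/-- The number of integer vectors mapped by the Vandermonde matrix of `σ` into the cube of side
its determinant. -/
noncomputable def nodeIndex {d : ℕ} (σ : Fin (d + 1) → ℕ) : ℕ :=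
  (boxPreimage (nodeMatrix σ) (fun _ => 0) (fun _ => |(nodeMatrix σ).det|)).ncard

theorem abs_det_le_nodeIndex {d : ℕ} {σ : Fin (d + 1) → ℕ} (hσ : Function.Injective σ) :
    |(nodeMatrix σ).det| ≤ nodeIndex σ :=
  abs_det_le_ncard_boxPreimage (nodeMatrix_det_ne_zero hσ) fun i => by
    simp [nodeMatrix, Matrix.vandermonde_apply]

theorem ncard_boxPreimage_two_pow {d : ℕ} {σ : Fin (d + 1) → ℕ} (hσ : Function.Injective σ)
    (k : Fin (d + 1) → ℕ) (x y : ℕ) (hxy : x ≤ y) :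
    (boxPreimage (nodeMatrix σ) (fun a => |(nodeMatrix σ).det| * (x * 2 ^ k a))
      (fun a => |(nodeMatrix σ).det| * (y * 2 ^ k a))).ncard =
      (y - x) ^ (d + 1) * 2 ^ (∑ a, k a) * nodeIndex σ := by
  rw [ncard_boxPreimage (nodeMatrix_det_ne_zero hσ), nodeIndex]
  congr 1
  have h : ∀ a, ((y : ℤ) * 2 ^ k a - x * 2 ^ k a).toNat = (y - x) * 2 ^ k a := fun a => by
    rw [← sub_mul, ← Nat.cast_sub hxy]
    exact_mod_cast Int.toNat_natCast _
  simp only [h, Finset.prod_mul_distrib, Finset.prod_const, Finset.card_univ, Fintype.card_fin,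
    Finset.prod_pow_eq_pow_sum]

theorem exists_intCast_ne_of_mem_boxPreimage {d p : ℕ} {σ : Fin (d + 1) → ℕ}
    (hσ : Function.Injective σ) {r : Fin (d + 1) → ℤ} (hr : ∀ a, r a ≤ p)
    {u u' : Fin (d + 1) → ℤ} (hu : u ∈ boxPreimage (nodeMatrix σ) (fun _ => 0) r)
    (hu' : u' ∈ boxPreimage (nodeMatrix σ) (fun _ => 0) r) (hne : u' ≠ u) (c : Fin (d + 1) → ℤ) :
    ∃ j, (((u + c) j : ℤ) : ZMod p) ≠ (((u' + c) j : ℤ) : ZMod p) := by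
  by_contra hcon
  push Not at hcon
  apply hne
  apply Matrix.mulVec_injective_of_det_ne_zero (nodeMatrix_det_ne_zero hσ)
  ext a
  have hdvd : (p : ℤ) ∣ (nodeMatrix σ).mulVec u' a - (nodeMatrix σ).mulVec u a := by
    rw [← Pi.sub_apply, ← Matrix.mulVec_sub, Matrix.mulVec, dotProduct]
    refine Finset.dvd_sum fun j _ => Dvd.dvd.mul_left ?_ _
    have h := hcon j
    simp only [Pi.add_apply, Int.cast_add, add_left_inj] at h
    exact (ZMod.intCast_eq_intCast_iff_dvd_sub _ _ _).mp h
  have h1 := hu a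
  have h2 := hu' a
  have h3 := hr a
  have h0 := Int.eq_zero_of_abs_lt_dvd hdvd (by rw [abs_lt]; constructor <;> linarith)
  linarith

theorem eq_of_two_pow_le_of_lt {D x : ℤ} (hD : 0 < D) {k l : ℕ} (h1 : D * (1 * 2 ^ k) ≤ x)
    (h2 : x < D * (2 * 2 ^ k)) (h3 : D * (1 * 2 ^ l) ≤ x) (h4 : x < D * (2 * 2 ^ l)) :
    k = l := by
  have key : ∀ {k l : ℕ}, D * (1 * 2 ^ k) ≤ x → x < D * (2 * 2 ^ l) → k ≤ l := by
    intro k l h h'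
    have h5 := lt_of_mul_lt_mul_left (h.trans_lt h') hD.le
    rw [one_mul, ← pow_succ'] at h5
    exact Nat.lt_succ_iff.mp ((pow_lt_pow_iff_right₀ (by norm_num : (1 : ℤ) < 2)).mp h5)
  exact le_antisymm (key h1 h4) (key h3 h2)

theorem exists_system_sum_card_le {d m p : ℕ} [Fact p.Prime] {ι : Type*} [Fintype ι]
    (σ : ι → Fin (d + 1) → ℕ) (hinj : Function.Injective σ) (hmono : ∀ I, StrictMono (σ I))
    (hlt : ∀ I a, σ I a < m) (hnn : ∀ I, ∀ t : ℕ, 0 ≤ ∏ a, ((t : ℤ) - (σ I a : ℤ)))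
    (K : ι → ℕ) (hK : ∀ I, 2 * ((2 * (d + 1)) ^ (d + 1) * 2 ^ K I * nodeIndex (σ I)) ≤ p)
    (hK' : ∀ I, p ≤ 4 * (2 * (d + 1)) ^ (d + 1) * (2 ^ K I * nodeIndex (σ I))) :
    ∃ (A : Matrix (Fin m) (Fin (d + 1)) ℤ) (b : Fin m → ℤ),
      (∀ i j, |A i j| ≤ (p + m ^ d : ℕ)) ∧
      ∑ I, ((Finset.univ : Finset (Fin (d + 1))).finsuppAntidiag (K I)).card ≤
        2 * (4 * (2 * (d + 1)) ^ (d + 1)) * (vertN m (d + 1) A b).ncard := by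
  classical
  have hp : 0 < p := (Fact.out : p.Prime).pos
  have : NeZero p := ⟨hp.ne'⟩
  set D : ι → ℤ := fun I => |(nodeMatrix (σ I)).det| with hDdef
  have hσ : ∀ I, Function.Injective (σ I) := fun I => (hmono I).injective
  have hD : ∀ I, 0 < D I := fun I => abs_pos.mpr (nodeMatrix_det_ne_zero (hσ I))
  choose v hv using fun I => exists_momentEval_add_pow_eq_prod (σ I)
  set P : Finset (Σ _ : ι, Fin (d + 1) →₀ ℕ) :=
    Finset.univ.sigma fun I => (Finset.univ : Finset (Fin (d + 1))).finsuppAntidiag (K I)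
    with hPdef
  have hPcard : P.card =
      ∑ I, ((Finset.univ : Finset (Fin (d + 1))).finsuppAntidiag (K I)).card :=
    Finset.card_sigma _ _
  have hPsum : ∀ j ∈ P, ∑ a, j.2 a = K j.1 := fun j hj =>
    (Finset.mem_finsuppAntidiag.mp (Finset.mem_sigma.mp hj).2).1
  have hfin : ∀ (x y : ℕ) (j : Σ _ : ι, Fin (d + 1) →₀ ℕ),
      (boxPreimage (nodeMatrix (σ j.1)) (fun a => D j.1 * (x * 2 ^ j.2 a))
        (fun a => D j.1 * (y * 2 ^ j.2 a))).Finite := fun x y j =>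
    boxPreimage_finite (nodeMatrix_det_ne_zero (hσ _)) _ _
  set box : ℕ → ℕ → (Σ _ : ι, Fin (d + 1) →₀ ℕ) → Finset (Fin (d + 1) → ℤ) :=
    fun x y j => (hfin x y j).toFinset with hbox
  have hboxmem : ∀ x y j u, u ∈ box x y j ↔ ∀ a,
      D j.1 * (x * 2 ^ j.2 a) ≤ (nodeMatrix (σ j.1)).mulVec u a ∧
      (nodeMatrix (σ j.1)).mulVec u a < D j.1 * (y * 2 ^ j.2 a) := fun x y j u => by
    rw [hbox, Set.Finite.mem_toFinset]; rfl
  have hboxcard : ∀ x y, x ≤ y → ∀ j ∈ P, (box x y j).card =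
      (y - x) ^ (d + 1) * 2 ^ K j.1 * nodeIndex (σ j.1) := fun x y hxy j hj => by
    rw [hbox, ← Set.ncard_eq_toFinset_card _ (hfin x y j), ncard_boxPreimage_two_pow (hσ _) _ _ _ hxy,
      hPsum j hj]
  set T := box 0 (2 * (d + 1))
  set G := box 1 2
  have hGT : ∀ j, G j ⊆ T j := fun j u hu => by
    rw [hboxmem] at hu ⊢
    intro a
    have h0 := hD j.1
    have h1 : D j.1 * ((2 : ℕ) * 2 ^ j.2 a) ≤ D j.1 * ((2 * (d + 1) : ℕ) * 2 ^ j.2 a) := by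
      gcongr
      omega
    refine ⟨le_trans ?_ (hu a).1, (hu a).2.trans_le h1⟩
    simp only [Nat.cast_zero, zero_mul, mul_zero]
    positivity
  obtain ⟨L, hL⟩ : ∃ L : ℤ, ∀ j ∈ P, ∀ u ∈ T j, ∀ i : Fin m, |momentEval u (i : ℤ)| ≤ L := by
    obtain ⟨L, hL⟩ := (((P.sigma T) ×ˢ (Finset.univ : Finset (Fin m))).image
      fun x => |momentEval x.1.2 (x.2 : ℤ)|).bddAbove
    refine ⟨L, fun j hj u hu i => hL ?_⟩
    refine Finset.mem_coe.mpr (Finset.mem_image.mpr ⟨(⟨j, u⟩, i), ?_, rfl⟩)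
    exact Finset.mem_product.mpr ⟨Finset.mem_sigma.mpr ⟨hj, hu⟩, Finset.mem_univ _⟩
  set N : ℤ := max (2 * L + 1) 0 with hN
  set R : (Fin d → ZMod p) × ZMod p → (Σ _ : ι, Fin (d + 1) →₀ ℕ) → (Fin (d + 1) → ℤ) → Prop :=
    fun ω j u => InShiftedLattice ω (u + N • v j.1) with hR
  obtain ⟨ω, S, hSP, hS, hcard⟩ := exists_card_le_of_forall_card_le
    (Ω := (Fin d → ZMod p) × ZMod p) P
    (fun ω j => ∃ u ∈ G j, R ω j u ∧ ∀ u' ∈ T j, R ω j u' → u' = u)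
    (2 * (4 * (2 * (d + 1)) ^ (d + 1))) (by
      intro j hj
      refine card_le_card_existsUnique (fun ω u => R ω j u) (G j) (T j) p _ hp (hGT j) ?_ ?_ ?_ ?_
      · rw [hboxcard _ _ (Nat.zero_le _) j hj]
        exact hK j.1
      · rw [hboxcard _ _ (by norm_num) j hj]
        simpa using hK' j.1
      · intro u _
        exact card_le_mul_card_inShiftedLattice _
      · intro u hu u' hu' hne
        refine sq_mul_card_inShiftedLattice_and_le _ _ ?_
        have hmem : ∀ u ∈ T j, u ∈ boxPreimage (nodeMatrix (σ j.1)) (fun _ => 0)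
            (fun a => D j.1 * ((2 * (d + 1) : ℕ) * 2 ^ j.2 a)) := fun u hu a => by
          simpa using (hboxmem _ _ _ _).mp hu a
        refine exists_intCast_ne_of_mem_boxPreimage (hσ j.1) (fun a => ?_)
          (hmem u (hGT j hu)) (hmem u' hu') hne _
        have h1 : D j.1 ≤ nodeIndex (σ j.1) := abs_det_le_nodeIndex (hσ j.1)
        have h2 : 2 ^ j.2 a ≤ 2 ^ K j.1 := by
          refine Nat.pow_le_pow_right (by norm_num) ?_
          rw [← hPsum j hj]
          exact Finset.single_le_sum (f := fun a => j.2 a) (fun _ _ => Nat.zero_le _)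
            (Finset.mem_univ a)
        have h3 : 2 * (d + 1) ≤ (2 * (d + 1)) ^ (d + 1) :=
          Nat.le_self_pow (by omega) _
        calc D j.1 * ((2 * (d + 1) : ℕ) * 2 ^ j.2 a)
            ≤ nodeIndex (σ j.1) * (((2 * (d + 1)) ^ (d + 1) : ℕ) * ((2 ^ K j.1 : ℕ) : ℤ)) := by
              gcongr
              exact_mod_cast h2
          _ = (((2 * (d + 1)) ^ (d + 1) * 2 ^ K j.1 * nodeIndex (σ j.1) : ℕ) : ℤ) := by
              push_cast; ring
          _ ≤ p := by
              have := hK j.1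
              exact_mod_cast (by omega : (2 * (d + 1)) ^ (d + 1) * 2 ^ K j.1 * nodeIndex (σ j.1) ≤ p))
  refine ⟨systemMatrix m ω, systemRhs m ω N, abs_systemMatrix_le m ω, ?_⟩
  rw [← hPcard]
  refine hcard.trans (Nat.mul_le_mul_left _ ?_)
  have hLN : ∀ j ∈ P, ∀ u ∈ T j, ∀ i : Fin m, (∀ a, (i : ℕ) ≠ σ j.1 a) →
      L < momentEval u (i : ℤ) + N * ∏ a, ((i : ℤ) - (σ j.1 a : ℤ)) := by
    intro j hj u hu i hi
    have h1 := abs_le.mp (hL j hj u hu i)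
    have h2 : 1 ≤ ∏ a, ((i : ℤ) - (σ j.1 a : ℤ)) := by
      refine Int.add_one_le_iff.mpr (lt_of_le_of_ne (hnn j.1 i) (Ne.symm ?_))
      refine Finset.prod_ne_zero_iff.mpr fun a _ => sub_ne_zero.mpr ?_
      exact_mod_cast hi a
    have h3 : N ≤ N * ∏ a, ((i : ℤ) - (σ j.1 a : ℤ)) :=
      le_mul_of_one_le_right (le_max_right _ _) h2
    have h4 : 2 * L + 1 ≤ N := le_max_left _ _
    linarith [h1.1]
  have hLnode : ∀ j ∈ P, ∀ u ∈ T j, ∀ i : Fin m, (∃ a, (i : ℕ) = σ j.1 a) →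
      0 ≤ momentEval u (i : ℤ) + N * ∏ a, ((i : ℤ) - (σ j.1 a : ℤ)) ∧
      momentEval u (i : ℤ) + N * ∏ a, ((i : ℤ) - (σ j.1 a : ℤ)) ≤ L := by
    rintro j hj u hu i ⟨a, ha⟩
    have h1 := abs_le.mp (hL j hj u hu i)
    rw [Finset.prod_eq_zero (Finset.mem_univ a) (by rw [← ha, sub_self]), mul_zero, add_zero]
    refine ⟨?_, h1.2⟩
    have h2 := ((hboxmem _ _ _ _).mp hu a).1
    rw [nodeMatrix_mulVec, ← ha] at h2
    simpa using h2
  have hvert : ∀ j ∈ S, ∃ u ∈ G j, ∃ z, latticePoint ω z = u + N • v j.1 ∧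
      (fun i => (z i : ℝ)) ∈ vertN m (d + 1) (systemMatrix m ω) (systemRhs m ω N) := by
    intro j hj
    obtain ⟨u, hu, hRu, huniq⟩ := hS j hj
    have hL0 : ∀ i : Fin m, 0 ≤ L := fun i =>
      (abs_nonneg _).trans (hL j (hSP hj) u (hGT j hu) i)
    refine ⟨u, hu, exists_mem_vertN (hlt j.1) (hv j.1) ω N (D j.1) (fun a => j.2 a)
      (fun a => by simpa using ((hboxmem _ _ _ _).mp hu a).2) hRu (fun u' hu' => ?_)
      (fun i => ?_)⟩
    · refine huniq u' ((hboxmem _ _ _ _).mpr fun a => ?_)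
      simpa using hu' a
    · by_cases hi : ∃ a, (i : ℕ) = σ j.1 a
      · exact (hLnode j (hSP hj) u (hGT j hu) i hi).1
      · push Not at hi
        exact (hL0 i).trans (hLN j (hSP hj) u (hGT j hu) i hi).le
  choose! u hu z hz hzmem using hvert
  rw [Set.ncard_eq_toFinset_card _ (vertN_finite _)]
  refine Finset.card_le_card_of_injOn (fun j i => (z j i : ℝ))
    (fun j hj => by simpa using hzmem j hj) ?_
  intro j hj j' hj' hEq
  have hzz : z j = z j' := by
    ext i
    exact Int.cast_injective (α := ℝ) (congrFun hEq i)
  have hw : u j + N • v j.1 = u j' + N • v j'.1 := by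
    rw [← hz j hj, ← hz j' hj', hzz]
  have hval : ∀ (j : Σ _ : ι, Fin (d + 1) →₀ ℕ) (t : ℤ),
      momentEval (u j + N • v j.1) t + N * t ^ (d + 1) =
        momentEval (u j) t + N * ∏ a, (t - (σ j.1 a : ℤ)) := fun j t => by
    rw [momentEval_add_smul, ← hv]; ring
  have hrange : ∀ j ∈ S, ∀ i : Fin m, (∃ a, (i : ℕ) = σ j.1 a) ↔
      momentEval (u j + N • v j.1) (i : ℤ) + N * (i : ℤ) ^ (d + 1) ≤ L := by
    intro j hj i
    rw [hval]
    constructor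
    · exact fun h => (hLnode j (hSP hj) _ (hGT j (hu j hj)) i h).2
    · intro h
      by_contra hi
      push Not at hi
      exact absurd (hLN j (hSP hj) _ (hGT j (hu j hj)) i hi) (not_lt.mpr h)
  have hsub : ∀ j ∈ S, ∀ j' ∈ S, u j + N • v j.1 = u j' + N • v j'.1 →
      Set.range (σ j.1) ⊆ Set.range (σ j'.1) := by
    rintro j hj j' hj' hw _ ⟨a, rfl⟩
    have h := (hrange j hj ⟨σ j.1 a, hlt _ _⟩).mp ⟨a, rfl⟩
    rw [hw] at h
    obtain ⟨a', ha'⟩ := (hrange j' hj' ⟨σ j.1 a, hlt _ _⟩).mpr h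
    exact ⟨a', ha'.symm⟩
  have hI : j.1 = j'.1 := by
    refine hinj (((hmono _).range_inj (hmono _)).mp ?_)
    exact Set.Subset.antisymm (hsub j hj j' hj' hw) (hsub j' hj' j hj hw.symm)
  have hGj := (hboxmem _ _ _ _).mp (hu j hj)
  have hGj' := (hboxmem _ _ _ _).mp (hu j' hj')
  have huu : u j = u j' := by
    rw [hI] at hw
    exact add_right_cancel hw
  rw [← huu] at hGj'
  obtain ⟨I, k⟩ := j
  obtain ⟨I', k'⟩ := j'
  simp only at hI
  subst hI
  congr 1
  ext a
  have h1 := hGj a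
  have h2 := hGj' a
  simp only [Nat.cast_one, Nat.cast_ofNat] at h1 h2
  exact eq_of_two_pow_le_of_lt (hD I) h1.1 h1.2 h2.1 h2.2

theorem pow_div_factorial_le_card_finsuppAntidiag (d K : ℕ) :
    (K : ℝ) ^ d / d.factorial ≤
      ((Finset.univ : Finset (Fin (d + 1))).finsuppAntidiag K).card := by
  rw [Finset.card_finsuppAntidiag_nat_eq_choose, Finset.card_univ, Fintype.card_fin,
    show d + 1 + K - 1 = d + K by omega, ← Nat.choose_symm_add]
  refine le_trans ?_ (Nat.pow_le_choose (α := ℝ) d (d + K))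
  gcongr
  omega

theorem exists_prime_add_le {α M : ℕ} (h : 2 * M + 4 ≤ α) :
    ∃ p : ℕ, p.Prime ∧ p + M ≤ α ∧ α ≤ 4 * p := by
  obtain ⟨p, hp, h1, h2⟩ := Nat.exists_prime_lt_and_le_two_mul ((α - M) / 2) (by omega)
  exact ⟨p, hp, by omega, by omega⟩

theorem exists_two_pow_near_div {α p Q : ℕ} (hQ : 0 < Q) (hp : α ≤ 4 * p)
    (hα : 64 * Q ^ 2 ≤ α) :
    ∃ K : ℕ, Q * 2 ^ K ≤ p ∧ p ≤ 2 * (Q * 2 ^ K) ∧ α ≤ 4 ^ K := by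
  have hQp : Q ≤ p := by nlinarith
  have hne : p / Q ≠ 0 := (Nat.div_pos hQp hQ).ne'
  have h1 : Q * 2 ^ Nat.log 2 (p / Q) ≤ p := by
    have := (Nat.le_div_iff_mul_le hQ).mp (Nat.pow_log_le_self 2 hne)
    linarith
  have h2 : p < 2 * (Q * 2 ^ Nat.log 2 (p / Q)) := by
    have := (Nat.div_lt_iff_lt_mul hQ).mp (Nat.lt_pow_succ_log_self (b := 2) (by norm_num) (p / Q))
    rw [pow_succ] at this
    linarith
  refine ⟨_, h1, h2.le, ?_⟩
  set t := 2 ^ Nat.log 2 (p / Q)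
  have h3 : (4 : ℕ) ^ Nat.log 2 (p / Q) = t ^ 2 := by
    rw [show (4 : ℕ) = 2 ^ 2 by norm_num, ← pow_mul, mul_comm, pow_mul]
  rw [h3]
  have h4 : α ≤ 8 * Q * t := by linarith
  have h5 : α * α ≤ 64 * Q ^ 2 * t ^ 2 := by nlinarith [Nat.mul_le_mul h4 h4]
  have h6 : 64 * Q ^ 2 * α ≤ 64 * Q ^ 2 * t ^ 2 := (Nat.mul_le_mul_right α hα).trans h5
  exact Nat.le_of_mul_le_mul_left h6 (by positivity)

theorem logb_two_le_of_le_four_pow {α K : ℕ} (hα : 1 ≤ α) (h : α ≤ 4 ^ K) :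
    Real.logb 2 α ≤ 2 * K := by
  rw [Real.logb_le_iff_le_rpow (by norm_num) (by exact_mod_cast hα)]
  have h1 : (2 : ℝ) ^ (2 * (K : ℝ)) = 4 ^ K := by
    rw [Real.rpow_mul (by norm_num), Real.rpow_natCast]
    norm_num
  rw [h1]
  exact_mod_cast h

theorem log_le_logb_two {α : ℕ} (hα : 1 ≤ α) : Real.log α ≤ Real.logb 2 α := by
  have h0 : 0 ≤ Real.log α := Real.log_nonneg (by exact_mod_cast hα)
  rw [Real.logb, le_div_iff₀ (Real.log_pos (by norm_num))]
  nlinarith [Real.log_two_lt_d9]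

theorem exists_system_xi_mul_logb_pow_le {d m : ℕ} (hm : d + 2 ≤ m) :
    ∃ α₀ : ℕ, 1 ≤ α₀ ∧ ∀ α : ℕ, α₀ ≤ α →
      ∃ (A : Matrix (Fin m) (Fin (d + 1)) ℤ) (b : Fin m → ℤ),
        (∀ i j, |A i j| ≤ (α : ℤ)) ∧
        (xi (d + 1) m : ℝ) / (4 ^ (d + 1 + 2) * ((d + 1 : ℕ) : ℝ) ^ (d + 1) * d.factorial) *
          Real.logb 2 α ^ d ≤ ((vertN m (d + 1) A b).ncard : ℝ) := by
  classical
  let ι := {I // I ∈ galeSets m (d + 1)}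
  let _ : Fintype ι := Finset.fintypeCoeSort _
  have hι : ∀ I : ι, (I.1 ⊆ Finset.range m ∧ I.1.card = d + 1) ∧
      ∀ k : ℕ, 0 ≤ ∏ i ∈ I.1, ((k : ℤ) - (i : ℤ)) := fun I => mem_galeSets.mp I.2
  let σ : ι → Fin (d + 1) → ℕ := fun I => I.1.orderEmbOfFin (hι I).1.2
  have hmono : ∀ I, StrictMono (σ I) := fun I => (I.1.orderEmbOfFin (hι I).1.2).strictMono
  have himage : ∀ I, Finset.univ.image (σ I) = I.1 := fun I => by
    rw [← Finset.coe_inj, Finset.coe_image, Finset.coe_univ, Set.image_univ]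
    exact Finset.range_orderEmbOfFin _ _
  have hinj : Function.Injective σ := fun I J h => by
    apply Subtype.ext
    rw [← himage I, ← himage J, h]
  have hlt : ∀ I a, σ I a < m := fun I a =>
    Finset.mem_range.mp ((hι I).1.1 (Finset.orderEmbOfFin_mem _ _ a))
  have hnn : ∀ I, ∀ t : ℕ, 0 ≤ ∏ a, ((t : ℤ) - (σ I a : ℤ)) := fun I t => by
    have h := (hι I).2 t
    rwa [← himage I, Finset.prod_image (hmono I).injective.injOn] at h
  let Q : ι → ℕ := fun I => 2 * ((2 * (d + 1)) ^ (d + 1) * nodeIndex (σ I))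
  have hQ : ∀ I, 0 < Q I := fun I => by
    have h1 := abs_det_le_nodeIndex (hmono I).injective
    have h2 := abs_pos.mpr (nodeMatrix_det_ne_zero (hmono I).injective)
    have h3 : 0 < nodeIndex (σ I) := by exact_mod_cast h2.trans_le h1
    positivity
  refine ⟨2 * m ^ d + 4 + 64 * (∑ I, Q I) ^ 2, by omega, fun α hα => ?_⟩
  obtain ⟨p, hp, hpα, hαp⟩ := exists_prime_add_le (α := α) (M := m ^ d) (by omega)
  have : Fact p.Prime := ⟨hp⟩
  have hKex : ∀ I, ∃ K : ℕ, Q I * 2 ^ K ≤ p ∧ p ≤ 2 * (Q I * 2 ^ K) ∧ α ≤ 4 ^ K := fun I => by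
    refine exists_two_pow_near_div (hQ I) hαp ?_
    have h1 : Q I ≤ ∑ I, Q I :=
      Finset.single_le_sum (f := Q) (fun _ _ => Nat.zero_le _) (Finset.mem_univ I)
    have h2 := Nat.pow_le_pow_left h1 2
    omega
  choose K hK1 hK2 hK3 using hKex
  obtain ⟨A, b, hA, hcard⟩ := exists_system_sum_card_le (p := p) σ hinj hmono hlt hnn K
    (fun I => le_trans (le_of_eq (by simp only [Q]; ring)) (hK1 I))
    (fun I => (hK2 I).trans (le_of_eq (by simp only [Q]; ring)))
  refine ⟨A, b, fun i j => (hA i j).trans (by exact_mod_cast hpα), ?_⟩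
  have hα1 : 1 ≤ α := by omega
  have hlog0 : 0 ≤ Real.logb 2 α := Real.logb_nonneg (by norm_num) (by exact_mod_cast hα1)
  have hxi : (xi (d + 1) m : ℝ) ≤ 2 * Fintype.card ι := by
    have h1 := xi_le_two_mul_choose (n := d + 1) (by omega) hm
    have h2 := choose_le_card_galeSets' (n := d + 1) (by omega) hm
    have h3 : Fintype.card ι = (galeSets m (d + 1)).card := Fintype.card_coe _
    rw [h3]
    exact_mod_cast h1.trans (Nat.mul_le_mul_left 2 h2)
  have hsum : (Fintype.card ι : ℝ) * ((Real.logb 2 α / 2) ^ d / d.factorial) ≤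
      2 * (4 * (2 * ((d + 1 : ℕ) : ℝ)) ^ (d + 1)) * (vertN m (d + 1) A b).ncard := by
    calc _ = ∑ _I : ι, (Real.logb 2 α / 2) ^ d / d.factorial := by simp
      _ ≤ ∑ I : ι, (((Finset.univ : Finset (Fin (d + 1))).finsuppAntidiag (K I)).card : ℝ) := by
        refine Finset.sum_le_sum fun I _ => le_trans ?_
          (pow_div_factorial_le_card_finsuppAntidiag d (K I))
        gcongr
        linarith [logb_two_le_of_le_four_pow hα1 (hK3 I)]
      _ ≤ _ := by exact_mod_cast hcard
  set V : ℝ := ((vertN m (d + 1) A b).ncard : ℝ)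
  set F : ℝ := (d.factorial : ℝ)
  set E : ℝ := ((d + 1 : ℕ) : ℝ) ^ (d + 1) with hE
  set Lg := Real.logb 2 α
  have hF : 0 < F := by simp only [F]; positivity
  have hEpos : 0 < E := by positivity
  have hV : 0 ≤ V := Nat.cast_nonneg _
  rw [div_mul_eq_mul_div, div_le_iff₀ (by positivity)]
  have h1 : (Fintype.card ι : ℝ) * Lg ^ d ≤ 2 ^ d * F * (8 * 2 ^ (d + 1) * E * V) := by
    rw [mul_pow, ← hE, div_pow, div_div, mul_div_assoc', div_le_iff₀ (by positivity)] at hsum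
    linarith
  calc (xi (d + 1) m : ℝ) * Lg ^ d ≤ 2 * Fintype.card ι * Lg ^ d := by gcongr
    _ = 2 * (Fintype.card ι * Lg ^ d) := by ring
    _ ≤ 2 * (2 ^ d * F * (8 * 2 ^ (d + 1) * E * V)) := by gcongr
    _ = 32 * 4 ^ d * (V * (E * F)) := by
      rw [show (4 : ℝ) = 2 * 2 by norm_num, mul_pow]; ring
    _ ≤ 64 * 4 ^ d * (V * (E * F)) := by gcongr; norm_num
    _ = V * (4 ^ (d + 1 + 2) * E * F) := by ring

theorem exists_polyhedron_with_many_vertices (n : ℕ) (hn : 2 ≤ n) :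
    ∃ c' : ℝ, 0 < c' ∧ ∀ m : ℕ, n + 1 ≤ m → ∃ α₀ : ℕ, ∀ α : ℕ, α₀ ≤ α →
      ∃ (A : Matrix (Fin m) (Fin n) ℤ) (b : Fin m → ℤ),
        (∀ i j, |A i j| ≤ (α : ℤ)) ∧
        (xi n m : ℝ) / (4 ^ (n + 2) * (n : ℝ) ^ n * (Nat.factorial (n - 1) : ℝ)) *
            Real.log (α : ℝ) ^ (n - 1) ≤ ((vertN m n A b).ncard : ℝ) ∧
        c' * (m : ℝ) ^ (n / 2) * Real.logb 2 (α : ℝ) ^ (n - 1) ≤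
          ((vertN m n A b).ncard : ℝ) := by
  have hn0 : (0 : ℝ) < n := by exact_mod_cast (by omega : 0 < n)
  refine ⟨(1 / (n : ℝ)) ^ (n / 2) / (n / 2).factorial /
    (4 ^ (n + 2) * (n : ℝ) ^ n * (Nat.factorial (n - 1) : ℝ)), by positivity, fun m hm => ?_⟩
  obtain ⟨d, rfl⟩ : ∃ d, n = d + 1 := ⟨n - 1, by omega⟩
  obtain ⟨α₀, hα₀, h⟩ := exists_system_xi_mul_logb_pow_le hm
  refine ⟨α₀, fun α hα => ?_⟩
  obtain ⟨A, b, hA, hV⟩ := h α hα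
  have hα1 : 1 ≤ α := hα₀.trans hα
  have hlog : 0 ≤ Real.log α := Real.log_nonneg (by exact_mod_cast hα1)
  have hle := log_le_logb_two hα1
  refine ⟨A, b, hA, le_trans ?_ hV, le_trans ?_ hV⟩
  · rw [Nat.add_sub_cancel]
    gcongr
  · rw [Nat.add_sub_cancel, div_mul_eq_mul_div]
    have h0 : 0 ≤ Real.logb 2 α := hlog.trans hle
    gcongr
    refine le_trans (le_of_eq ?_) (pow_div_factorial_le_xi hn hm)
    rw [div_pow, div_pow, one_pow]
    ring
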